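/- arXiv:2202.10351 — 14 statements merged into one kernel-verified Lean document; each statement's English description precedes it below -/
import Mathlib

section
/- Let m₁, m₂, m₃ > 0 be real numbers that are not all equal, and let u < 0 be a real number (the common value of U'(D²) at the equilateral chord distance). Set A = √(m₁² + m₂² + m₃² − m₁m₂ − m₂m₃ − m₃m₁) (which is > 0) and w = −4Au (so w > 0). Then there exist real numbers θ₁, θ₂, θ₃ with θ₁ − θ₂ = 2π/3 and θ₂ − θ₃ = 2π/3 such that m₁ sin(2θ₁) + m₂ sin(2θ₂) + m₃ sin(2θ₃) = 0, and for each k ∈ {1,2,3}, (w/2)·m_k·sin(2θ_k) = −2·Σ_{i≠k} m_k m_i sin(θ_k − θ_i)·u. (Equilateral relative equilibrium on a rotating meridian for a generic potential: the equilateral triangle θ₁ − θ₂ = θ₂ − θ₃ = θ₃ − θ₁ = 2π/3 is a rigid rotator for any masses, with angular velocity ω satisfying ω² = −4AU'.) -/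
open Real in
theorem sin_two_mul_pi_div_three : sin (2 * π / 3) = √3 / 2 := by
  rw [show 2 * π / 3 = π - π / 3 by ring, sin_pi_sub, sin_pi_div_three]

open Real in
theorem cos_two_mul_pi_div_three : cos (2 * π / 3) = -1 / 2 := by
  rw [show 2 * π / 3 = π - π / 3 by ring, cos_pi_sub, cos_pi_div_three]
  ring

open Real in
theorem sin_four_mul_pi_div_three : sin (4 * π / 3) = -(√3 / 2) := by
  rw [show 4 * π / 3 = π / 3 + π by ring, sin_add_pi, sin_pi_div_three]

open Real in
theorem cos_four_mul_pi_div_three : cos (4 * π / 3) = -1 / 2 := by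
  rw [show 4 * π / 3 = π / 3 + π by ring, cos_add_pi, cos_pi_div_three]
  ring

/-- Every point of the plane has polar coordinates. -/
theorem exists_mul_cos_mul_sin (a b : ℝ) :
    ∃ x : ℝ, √(a ^ 2 + b ^ 2) * Real.cos x = a ∧ √(a ^ 2 + b ^ 2) * Real.sin x = b := by
  refine ⟨Complex.arg ⟨a, b⟩, ?_⟩
  have hnorm : √(a ^ 2 + b ^ 2) = ‖(⟨a, b⟩ : ℂ)‖ := by
    rw [Complex.norm_def, Complex.normSq_mk, sq, sq]
  rw [hnorm]
  exact ⟨Complex.norm_mul_cos_arg _, Complex.norm_mul_sin_arg _⟩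

/-- Equilateral relative equilibrium on a rotating meridian for a generic potential:
the equilateral triangle θ₁ − θ₂ = θ₂ − θ₃ = θ₃ − θ₁ = 2π/3 is a rigid rotator for any
masses, with angular velocity ω satisfying ω² = −4AU'. -/
theorem stmt_0 (m₁ m₂ m₃ u A w : ℝ)
    (hm₁ : 0 < m₁) (hm₂ : 0 < m₂) (hm₃ : 0 < m₃)
    (hne : ¬ (m₁ = m₂ ∧ m₂ = m₃))
    (hu : u < 0)
    (hA : A = Real.sqrt (m₁ ^ 2 + m₂ ^ 2 + m₃ ^ 2 - m₁ * m₂ - m₂ * m₃ - m₃ * m₁))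
    (hw : w = -4 * A * u) :
    0 < A ∧ 0 < w ∧
    ∃ θ₁ θ₂ θ₃ : ℝ,
      θ₁ - θ₂ = 2 * Real.pi / 3 ∧ θ₂ - θ₃ = 2 * Real.pi / 3 ∧
      m₁ * Real.sin (2 * θ₁) + m₂ * Real.sin (2 * θ₂) + m₃ * Real.sin (2 * θ₃) = 0 ∧
      w / 2 * (m₁ * Real.sin (2 * θ₁)) =
        -2 * (m₁ * m₂ * Real.sin (θ₁ - θ₂) * u + m₁ * m₃ * Real.sin (θ₁ - θ₃) * u) ∧
      w / 2 * (m₂ * Real.sin (2 * θ₂)) =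
        -2 * (m₂ * m₁ * Real.sin (θ₂ - θ₁) * u + m₂ * m₃ * Real.sin (θ₂ - θ₃) * u) ∧
      w / 2 * (m₃ * Real.sin (2 * θ₃)) =
        -2 * (m₃ * m₁ * Real.sin (θ₃ - θ₁) * u + m₃ * m₂ * Real.sin (θ₃ - θ₂) * u) := by
  have hpos : 0 < m₁ ^ 2 + m₂ ^ 2 + m₃ ^ 2 - m₁ * m₂ - m₂ * m₃ - m₃ * m₁ := by
    by_contra! h
    have h12 : (m₁ - m₂) ^ 2 = 0 := by
      nlinarith [sq_nonneg (m₁ - m₂), sq_nonneg (m₂ - m₃), sq_nonneg (m₃ - m₁)]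
    have h23 : (m₂ - m₃) ^ 2 = 0 := by
      nlinarith [sq_nonneg (m₁ - m₂), sq_nonneg (m₂ - m₃), sq_nonneg (m₃ - m₁)]
    exact hne ⟨sub_eq_zero.mp (pow_eq_zero_iff two_ne_zero |>.mp h12),
      sub_eq_zero.mp (pow_eq_zero_iff two_ne_zero |>.mp h23)⟩
  have hA_pos : 0 < A := hA ▸ Real.sqrt_pos.mpr hpos
  refine ⟨hA_pos, by rw [hw]; nlinarith [mul_pos hA_pos (neg_pos.mpr hu)], ?_⟩
  have h3 : √(3 : ℝ) ^ 2 = 3 := Real.sq_sqrt (by norm_num)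
  obtain ⟨x, hcos, hsin⟩ := exists_mul_cos_mul_sin ((m₂ + m₃) / 2 - m₁) (√3 / 2 * (m₂ - m₃))
  have hrad : ((m₂ + m₃) / 2 - m₁) ^ 2 + (√3 / 2 * (m₂ - m₃)) ^ 2 =
      m₁ ^ 2 + m₂ ^ 2 + m₃ ^ 2 - m₁ * m₂ - m₂ * m₃ - m₃ * m₁ := by
    linear_combination (m₂ - m₃) ^ 2 / 4 * h3
  rw [hrad, ← hA] at hcos hsin
  have e₁ : A * Real.sin (2 * (x / 2)) = √3 / 2 * (m₂ - m₃) := by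
    rw [mul_div_cancel₀ x two_ne_zero, hsin]
  have e₂ : A * Real.sin (2 * (x / 2 - 2 * Real.pi / 3)) = √3 / 2 * (m₃ - m₁) := by
    rw [show 2 * (x / 2 - 2 * Real.pi / 3) = x - 4 * Real.pi / 3 by ring, Real.sin_sub,
      sin_four_mul_pi_div_three, cos_four_mul_pi_div_three]
    linear_combination -1 / 2 * hsin + √3 / 2 * hcos
  have e₃ : A * Real.sin (2 * (x / 2 - 4 * Real.pi / 3)) = √3 / 2 * (m₁ - m₂) := by
    rw [show 2 * (x / 2 - 4 * Real.pi / 3) = x - 2 * Real.pi / 3 - 2 * Real.pi by ring,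
      Real.sin_sub_two_pi, Real.sin_sub, sin_two_mul_pi_div_three, cos_two_mul_pi_div_three]
    linear_combination -1 / 2 * hsin - √3 / 2 * hcos
  refine ⟨x / 2, x / 2 - 2 * Real.pi / 3, x / 2 - 4 * Real.pi / 3, by ring, by ring, ?_, ?_, ?_, ?_⟩
  · apply mul_left_cancel₀ hA_pos.ne'
    linear_combination m₁ * e₁ + m₂ * e₂ + m₃ * e₃
  · rw [show x / 2 - (x / 2 - 2 * Real.pi / 3) = 2 * Real.pi / 3 by ring,
      show x / 2 - (x / 2 - 4 * Real.pi / 3) = 4 * Real.pi / 3 by ring,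
      sin_two_mul_pi_div_three, sin_four_mul_pi_div_three, hw]
    linear_combination -2 * u * m₁ * e₁
  · rw [show x / 2 - 2 * Real.pi / 3 - x / 2 = -(2 * Real.pi / 3) by ring,
      show x / 2 - 2 * Real.pi / 3 - (x / 2 - 4 * Real.pi / 3) = 2 * Real.pi / 3 by ring,
      Real.sin_neg, sin_two_mul_pi_div_three, hw]
    linear_combination -2 * u * m₂ * e₂
  · rw [show x / 2 - 4 * Real.pi / 3 - x / 2 = -(4 * Real.pi / 3) by ring,
      show x / 2 - 4 * Real.pi / 3 - (x / 2 - 2 * Real.pi / 3) = -(2 * Real.pi / 3) by ring,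
      Real.sin_neg, Real.sin_neg, sin_two_mul_pi_div_three, sin_four_mul_pi_div_three, hw]
    linear_combination -2 * u * m₃ * e₃
end

section
/- Let m₁, m₂, m₃ > 0, let ω be a real number, let θ₁, θ₂, θ₃ be real numbers, and let u₁₂, u₂₃, u₃₁ be real numbers with u_{ij} = u_{ji}. Suppose m₁ sin(2θ₁) + m₂ sin(2θ₂) + m₃ sin(2θ₃) = 0 and for each k ∈ {1,2,3}, (ω²/2)·m_k·sin(2θ_k) = −2·Σ_{i≠k} m_k m_i sin(θ_k − θ_i)·u_{ki}. Then the shifted angles θ'_k = θ_k + π/2 satisfy m₁ sin(2θ'₁) + m₂ sin(2θ'₂) + m₃ sin(2θ'₃) = 0 and, for each k, (ω²/2)·m_k·sin(2θ'_k) = −2·Σ_{i≠k} m_k m_i sin(θ'_k − θ'_i)·(−u_{ki}). (If a shape is a rigid rotator for the attractive potential U, the same shape is a rigid rotator for the repulsive potential −U, and the two configurations differ by an overall rotation of 90 degrees.) -/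
/-- If a shape is a rigid rotator for the attractive potential U, the same shape is a
rigid rotator for the repulsive potential −U, and the two configurations differ by an
overall rotation of 90 degrees. -/
theorem stmt_1 (m₁ m₂ m₃ ω θ₁ θ₂ θ₃ u₁₂ u₂₃ u₃₁ : ℝ)
    (hm₁ : 0 < m₁) (hm₂ : 0 < m₂) (hm₃ : 0 < m₃)
    (hc : m₁ * Real.sin (2 * θ₁) + m₂ * Real.sin (2 * θ₂) + m₃ * Real.sin (2 * θ₃) = 0)
    (h1 : ω ^ 2 / 2 * (m₁ * Real.sin (2 * θ₁)) =
      -2 * (m₁ * m₂ * Real.sin (θ₁ - θ₂) * u₁₂ + m₁ * m₃ * Real.sin (θ₁ - θ₃) * u₃₁))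
    (h2 : ω ^ 2 / 2 * (m₂ * Real.sin (2 * θ₂)) =
      -2 * (m₂ * m₁ * Real.sin (θ₂ - θ₁) * u₁₂ + m₂ * m₃ * Real.sin (θ₂ - θ₃) * u₂₃))
    (h3 : ω ^ 2 / 2 * (m₃ * Real.sin (2 * θ₃)) =
      -2 * (m₃ * m₁ * Real.sin (θ₃ - θ₁) * u₃₁ + m₃ * m₂ * Real.sin (θ₃ - θ₂) * u₂₃)) :
    m₁ * Real.sin (2 * (θ₁ + Real.pi / 2)) + m₂ * Real.sin (2 * (θ₂ + Real.pi / 2)) +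
      m₃ * Real.sin (2 * (θ₃ + Real.pi / 2)) = 0 ∧
    ω ^ 2 / 2 * (m₁ * Real.sin (2 * (θ₁ + Real.pi / 2))) =
      -2 * (m₁ * m₂ * Real.sin ((θ₁ + Real.pi / 2) - (θ₂ + Real.pi / 2)) * (-u₁₂) +
            m₁ * m₃ * Real.sin ((θ₁ + Real.pi / 2) - (θ₃ + Real.pi / 2)) * (-u₃₁)) ∧
    ω ^ 2 / 2 * (m₂ * Real.sin (2 * (θ₂ + Real.pi / 2))) =
      -2 * (m₂ * m₁ * Real.sin ((θ₂ + Real.pi / 2) - (θ₁ + Real.pi / 2)) * (-u₁₂) +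
            m₂ * m₃ * Real.sin ((θ₂ + Real.pi / 2) - (θ₃ + Real.pi / 2)) * (-u₂₃)) ∧
    ω ^ 2 / 2 * (m₃ * Real.sin (2 * (θ₃ + Real.pi / 2))) =
      -2 * (m₃ * m₁ * Real.sin ((θ₃ + Real.pi / 2) - (θ₁ + Real.pi / 2)) * (-u₃₁) +
            m₃ * m₂ * Real.sin ((θ₃ + Real.pi / 2) - (θ₂ + Real.pi / 2)) * (-u₂₃)) := by
  have sin_shift (θ : ℝ) : Real.sin (2 * (θ + Real.pi / 2)) = -Real.sin (2 * θ) := by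
    rw [← Real.sin_add_pi]
    ring_nf
  simp only [sin_shift, add_sub_add_right_eq_sub]
  refine ⟨?_, ?_, ?_, ?_⟩ <;> linarith
end

section
/- Let m₁, m₂, m₃ > 0 and θ₁, θ₂, θ₃ ∈ ℝ. Define A ≥ 0 by A² = m₁² + m₂² + m₃² + 2·( m₁m₂ cos(2(θ₂ − θ₁)) + m₂m₃ cos(2(θ₃ − θ₂)) + m₃m₁ cos(2(θ₃ − θ₁)) ). Suppose A ≠ 0 and m₁ sin(2θ₁) + m₂ sin(2θ₂) + m₃ sin(2θ₃) = 0. Then there exists s ∈ {1, −1} such that for every k ∈ {1,2,3}: A·sin(2θ_k) = s·Σ_{i≠k} m_i sin(2(θ_k − θ_i)) and A·cos(2θ_k) = s·( m_k + Σ_{i≠k} m_i cos(2(θ_k − θ_i)) ). (Translation formula between the shape variables θ_i − θ_j and the configuration variables θ_k.) -/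
/-- Translation formula between the shape variables θ_i − θ_j and the configuration
variables θ_k. -/
theorem stmt_2 (m₁ m₂ m₃ θ₁ θ₂ θ₃ A : ℝ)
    (hm₁ : 0 < m₁) (hm₂ : 0 < m₂) (hm₃ : 0 < m₃)
    (hA0 : 0 ≤ A)
    (hA2 : A ^ 2 = m₁ ^ 2 + m₂ ^ 2 + m₃ ^ 2 +
      2 * (m₁ * m₂ * Real.cos (2 * (θ₂ - θ₁)) + m₂ * m₃ * Real.cos (2 * (θ₃ - θ₂)) +
           m₃ * m₁ * Real.cos (2 * (θ₃ - θ₁))))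
    (hAne : A ≠ 0)
    (hc : m₁ * Real.sin (2 * θ₁) + m₂ * Real.sin (2 * θ₂) + m₃ * Real.sin (2 * θ₃) = 0) :
    ∃ s : ℝ, (s = 1 ∨ s = -1) ∧
      A * Real.sin (2 * θ₁) =
        s * (m₂ * Real.sin (2 * (θ₁ - θ₂)) + m₃ * Real.sin (2 * (θ₁ - θ₃))) ∧
      A * Real.sin (2 * θ₂) =
        s * (m₁ * Real.sin (2 * (θ₂ - θ₁)) + m₃ * Real.sin (2 * (θ₂ - θ₃))) ∧
      A * Real.sin (2 * θ₃) =
        s * (m₁ * Real.sin (2 * (θ₃ - θ₁)) + m₂ * Real.sin (2 * (θ₃ - θ₂))) ∧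
      A * Real.cos (2 * θ₁) =
        s * (m₁ + m₂ * Real.cos (2 * (θ₁ - θ₂)) + m₃ * Real.cos (2 * (θ₁ - θ₃))) ∧
      A * Real.cos (2 * θ₂) =
        s * (m₂ + m₁ * Real.cos (2 * (θ₂ - θ₁)) + m₃ * Real.cos (2 * (θ₂ - θ₃))) ∧
      A * Real.cos (2 * θ₃) =
        s * (m₃ + m₁ * Real.cos (2 * (θ₃ - θ₁)) + m₂ * Real.cos (2 * (θ₃ - θ₂))) := by
  have h₁ := Real.sin_sq_add_cos_sq (2 * θ₁)
  have h₂ := Real.sin_sq_add_cos_sq (2 * θ₂)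
  have h₃ := Real.sin_sq_add_cos_sq (2 * θ₃)
  simp only [mul_sub, Real.sin_sub, Real.cos_sub] at hA2 ⊢
  have hsq : A ^ 2 =
      (m₁ * Real.cos (2 * θ₁) + m₂ * Real.cos (2 * θ₂) + m₃ * Real.cos (2 * θ₃)) ^ 2 := by
    linear_combination hA2 - m₁ ^ 2 * h₁ - m₂ ^ 2 * h₂ - m₃ ^ 2 * h₃ +
      (m₁ * Real.sin (2 * θ₁) + m₂ * Real.sin (2 * θ₂) + m₃ * Real.sin (2 * θ₃)) * hc
  obtain ⟨s, hs, hA⟩ : ∃ s : ℝ, (s = 1 ∨ s = -1) ∧ A =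
      s * (m₁ * Real.cos (2 * θ₁) + m₂ * Real.cos (2 * θ₂) + m₃ * Real.cos (2 * θ₃)) := by
    rcases sq_eq_sq_iff_eq_or_eq_neg.mp hsq with h | h
    · exact ⟨1, Or.inl rfl, by rw [h, one_mul]⟩
    · exact ⟨-1, Or.inr rfl, by rw [h, neg_one_mul]⟩
  refine ⟨s, hs, ?_, ?_, ?_, ?_, ?_, ?_⟩
  · linear_combination Real.sin (2 * θ₁) * hA + s * Real.cos (2 * θ₁) * hc
  · linear_combination Real.sin (2 * θ₂) * hA + s * Real.cos (2 * θ₂) * hc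
  · linear_combination Real.sin (2 * θ₃) * hA + s * Real.cos (2 * θ₃) * hc
  · linear_combination Real.cos (2 * θ₁) * hA - s * Real.sin (2 * θ₁) * hc + s * m₁ * h₁
  · linear_combination Real.cos (2 * θ₂) * hA - s * Real.sin (2 * θ₂) * hc + s * m₂ * h₂
  · linear_combination Real.cos (2 * θ₃) * hA - s * Real.sin (2 * θ₃) * hc + s * m₃ * h₃
end

section
/- Let μ₁, μ₂, μ₃ > 0 and ρ > 0 be real numbers, and let a, b ∈ ℝ satisfy sin a = ρμ₃, sin b = ρμ₁, and sin(a + b) = −ρμ₂. Then cos a = ( μ₃² − (μ₁² + μ₂²) ) / (2 μ₁ μ₂). (Derivation of the cosine theorem from the sine theorem for the equatorial relative equilibria.) -/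
/-- The cosine theorem in sine form, for a triangle with angles `a`, `b` and `π - (a + b)`. -/
theorem Real.sin_sq_eq_sin_add_sq_add_sin_sq (a b : ℝ) :
    Real.sin a ^ 2 =
      Real.sin (a + b) ^ 2 + Real.sin b ^ 2 - 2 * Real.sin (a + b) * Real.sin b * Real.cos a := by
  rw [Real.sin_add]
  linear_combination (-Real.sin a ^ 2) * Real.sin_sq_add_cos_sq b
    + Real.sin b ^ 2 * Real.sin_sq_add_cos_sq a

/-- Derivation of the cosine theorem from the sine theorem for the equatorial relative
equilibria. -/
theorem stmt_4 (μ₁ μ₂ μ₃ ρ a b : ℝ)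
    (hμ₁ : 0 < μ₁) (hμ₂ : 0 < μ₂) (hμ₃ : 0 < μ₃) (hρ : 0 < ρ)
    (ha : Real.sin a = ρ * μ₃) (hb : Real.sin b = ρ * μ₁)
    (hab : Real.sin (a + b) = -(ρ * μ₂)) :
    Real.cos a = (μ₃ ^ 2 - (μ₁ ^ 2 + μ₂ ^ 2)) / (2 * μ₁ * μ₂) := by
  have h := Real.sin_sq_eq_sin_add_sq_add_sin_sq a b
  rw [ha, hb, hab] at h
  rw [eq_div_iff (by positivity)]
  refine mul_left_cancel₀ (pow_ne_zero 2 hρ.ne') ?_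
  linear_combination -h
end

section
/- Let μ₁, μ₂, μ₃ > 0 satisfy the strict triangle inequalities μ₁ < μ₂ + μ₃, μ₂ < μ₃ + μ₁, and μ₃ < μ₁ + μ₂. Then there exists a unique triple (a, b, c) with a, b, c ∈ (0, π), a + b + c = 2π, and sin a / μ₃ = sin b / μ₁ = sin c / μ₂. (Existence and uniqueness of the rigid rotator on the Equator: for a given mass ratio satisfying the triangle inequalities on the μ_k there is exactly one equatorial relative equilibrium shape.) -/
/-- If the angles `a`, `b`, `c` sum to `2 * π` and their sines are in proportion `x : y : z`,
then `a` obeys the law of cosines for the supplementary triangle. -/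
theorem cos_eq_of_sin_proportional {a b c x y z k : ℝ} (hk : k ≠ 0) (hy : y ≠ 0) (hz : z ≠ 0)
    (habc : a + b + c = 2 * Real.pi)
    (ha : Real.sin a = k * x) (hb : Real.sin b = k * y) (hc : Real.sin c = k * z) :
    Real.cos a = (x ^ 2 - y ^ 2 - z ^ 2) / (2 * y * z) := by
  have sin_eq : ∀ s t u : ℝ, s + t + u = 2 * Real.pi →
      Real.sin s = -(Real.sin t * Real.cos u + Real.cos t * Real.sin u) := by
    intro s t u h
    rw [← Real.sin_add, ← Real.sin_two_pi_sub]
    congr 1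
    linarith
  have hx' : x = -(y * Real.cos c + Real.cos b * z) := by
    apply mul_left_cancel₀ hk
    have := sin_eq a b c habc
    rw [ha, hb, hc] at this
    linear_combination this
  have hy' : y = -(z * Real.cos a + Real.cos c * x) := by
    apply mul_left_cancel₀ hk
    have := sin_eq b c a (by linarith)
    rw [ha, hb, hc] at this
    linear_combination this
  have hz' : z = -(x * Real.cos b + Real.cos a * y) := by
    apply mul_left_cancel₀ hk
    have := sin_eq c a b (by linarith)
    rw [ha, hb, hc] at this
    linear_combination this
  rw [eq_div_iff (by positivity)]
  linear_combination (-x) * hx' + y * hy' + z * hz'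

/-- The sine of the supplement of a triangle's angle, in terms of the side lengths. -/
theorem sin_arccos_sides {x y z : ℝ} (hy : 0 < y) (hz : 0 < z) :
    Real.sin (Real.arccos ((x ^ 2 - y ^ 2 - z ^ 2) / (2 * y * z))) =
      √((x + y + z) * (y + z - x) * (z + x - y) * (x + y - z)) / (2 * y * z) := by
  rw [Real.sin_arccos, ← Real.sqrt_sq (by positivity : 0 ≤ 2 * y * z),
    ← Real.sqrt_div' _ (by positivity), Real.sqrt_sq (by positivity)]
  congr 1
  field_simp
  ring

/-- The cosine of the supplement of a triangle's angle lies strictly between `-1` and `1`. -/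
theorem cos_sides_mem_Ioo {x y z : ℝ} (hx : 0 < x) (hy : 0 < y) (hz : 0 < z)
    (h₁ : x < y + z) (h₂ : y < z + x) (h₃ : z < x + y) :
    (x ^ 2 - y ^ 2 - z ^ 2) / (2 * y * z) ∈ Set.Ioo (-1) 1 := by
  have hyz : 0 < 2 * y * z := by positivity
  constructor
  · rw [lt_div_iff₀ hyz]
    nlinarith [mul_pos (sub_pos.2 h₂) (sub_pos.2 h₃)]
  · rw [div_lt_iff₀ hyz]
    nlinarith [mul_pos (sub_pos.2 h₁) (by positivity : 0 < x + y + z)]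

/-- Existence and uniqueness of the rigid rotator on the Equator: for a given mass ratio
satisfying the triangle inequalities on the μ_k there is exactly one equatorial relative
equilibrium shape. -/
theorem stmt_6 (μ₁ μ₂ μ₃ : ℝ)
    (hμ₁ : 0 < μ₁) (hμ₂ : 0 < μ₂) (hμ₃ : 0 < μ₃)
    (h₁ : μ₁ < μ₂ + μ₃) (h₂ : μ₂ < μ₃ + μ₁) (h₃ : μ₃ < μ₁ + μ₂) :
    ∃! p : ℝ × ℝ × ℝ,
      p.1 ∈ Set.Ioo 0 Real.pi ∧ p.2.1 ∈ Set.Ioo 0 Real.pi ∧ p.2.2 ∈ Set.Ioo 0 Real.pi ∧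
      p.1 + p.2.1 + p.2.2 = 2 * Real.pi ∧
      Real.sin p.1 / μ₃ = Real.sin p.2.1 / μ₁ ∧
      Real.sin p.2.1 / μ₁ = Real.sin p.2.2 / μ₂ := by
  obtain ⟨hu₁, hu₂⟩ := cos_sides_mem_Ioo hμ₃ hμ₁ hμ₂ h₃ (by linarith) (by linarith)
  obtain ⟨hv₁, hv₂⟩ := cos_sides_mem_Ioo hμ₁ hμ₂ hμ₃ h₁ (by linarith) (by linarith)
  have hsa := sin_arccos_sides (x := μ₃) hμ₁ hμ₂
  have hsb := sin_arccos_sides (x := μ₁) hμ₂ hμ₃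
  have hca := Real.cos_arccos hu₁.le hu₂.le
  have hcb := Real.cos_arccos hv₁.le hv₂.le
  have ha₀ := Real.arccos_pos.2 hu₂
  have ha₁ := Real.arccos_lt_pi.2 hu₁
  have hb₀ := Real.arccos_pos.2 hv₂
  have hb₁ := Real.arccos_lt_pi.2 hv₁
  set a := Real.arccos ((μ₃ ^ 2 - μ₁ ^ 2 - μ₂ ^ 2) / (2 * μ₁ * μ₂))
  set b := Real.arccos ((μ₁ ^ 2 - μ₂ ^ 2 - μ₃ ^ 2) / (2 * μ₂ * μ₃))
  rw [show (μ₁ + μ₂ + μ₃) * (μ₂ + μ₃ - μ₁) * (μ₃ + μ₁ - μ₂) * (μ₁ + μ₂ - μ₃) =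
    (μ₃ + μ₁ + μ₂) * (μ₁ + μ₂ - μ₃) * (μ₂ + μ₃ - μ₁) * (μ₃ + μ₁ - μ₂) by ring] at hsb
  have hS : 0 < √((μ₃ + μ₁ + μ₂) * (μ₁ + μ₂ - μ₃) * (μ₂ + μ₃ - μ₁) * (μ₃ + μ₁ - μ₂)) := by
    have := sub_pos.2 h₁
    have := sub_pos.2 h₂
    have := sub_pos.2 h₃
    positivity
  set S := √((μ₃ + μ₁ + μ₂) * (μ₁ + μ₂ - μ₃) * (μ₂ + μ₃ - μ₁) * (μ₃ + μ₁ - μ₂))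
  have hsc : Real.sin (2 * Real.pi - a - b) = S / (2 * μ₃ * μ₁) := by
    rw [sub_sub, Real.sin_two_pi_sub, Real.sin_add, hsa, hsb, hca, hcb]
    field_simp
    ring
  have hc : 2 * Real.pi - a - b < Real.pi := by
    by_contra! h
    have hpos : 0 < Real.sin (2 * Real.pi - a - b) := by rw [hsc]; positivity
    have hnonneg := Real.sin_nonneg_of_nonneg_of_le_pi (x := a + b) (by linarith) (by linarith)
    rw [sub_sub, Real.sin_two_pi_sub] at hpos
    linarith
  refine ⟨(a, b, 2 * Real.pi - a - b), ⟨⟨ha₀, ha₁⟩, ⟨hb₀, hb₁⟩, ⟨by simp only; linarith, hc⟩,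
    by simp only; ring, ?_, ?_⟩, ?_⟩
  · simp only [hsa, hsb]
    field_simp
  · simp only [hsb, hsc]
    field_simp
  · rintro ⟨a', b', c'⟩ ⟨⟨ha₀', ha₁'⟩, ⟨hb₀', hb₁'⟩, -, hsum, hab, hbc⟩
    simp only at ha₀' ha₁' hb₀' hb₁' hsum hab hbc
    have hk : Real.sin b' / μ₁ ≠ 0 :=
      (div_pos (Real.sin_pos_of_pos_of_lt_pi hb₀' hb₁') hμ₁).ne'
    have hA : Real.sin a' = Real.sin b' / μ₁ * μ₃ := (div_eq_iff hμ₃.ne').1 hab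
    have hB : Real.sin b' = Real.sin b' / μ₁ * μ₁ := (div_mul_cancel₀ _ hμ₁.ne').symm
    have hC : Real.sin c' = Real.sin b' / μ₁ * μ₂ := (div_eq_iff hμ₂.ne').1 hbc.symm
    have ha' : a' = a := by
      rw [← Real.arccos_cos ha₀'.le ha₁'.le,
        cos_eq_of_sin_proportional hk hμ₁.ne' hμ₂.ne' hsum hA hB hC]
    have hb' : b' = b := by
      rw [← Real.arccos_cos hb₀'.le hb₁'.le,
        cos_eq_of_sin_proportional hk hμ₂.ne' hμ₃.ne' (by linarith) hB hC hA]
    have hc' : c' = 2 * Real.pi - a - b := by linarith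
    rw [ha', hb', hc']
end

section
/- For every real number d there exists exactly one x ∈ (0, π/2) such that 4 cos(2x) − d sin²(2x) = 0. (For θ₂ − θ₁ = π/2, there is exactly one rigid rotator on a rotating meridian with the third body in region I, i.e. with θ₁ < θ₃ < θ₂, for every value of d = ν₁ − ν₂.) -/
/-- For θ₂ − θ₁ = π/2 there is exactly one rigid rotator on a rotating meridian with the
third body in region I, for every value of d = ν₁ − ν₂. -/
theorem stmt_9 (d : ℝ) :
    ∃! x : ℝ, x ∈ Set.Ioo 0 (Real.pi / 2) ∧
      4 * Real.cos (2 * x) - d * Real.sin (2 * x) ^ 2 = 0 := by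
  have hpi := Real.pi_pos
  have hcont : ContinuousOn
      (fun x : ℝ => 4 * Real.cos (2 * x) - d * Real.sin (2 * x) ^ 2)
      (Set.Icc 0 (Real.pi / 2)) := by fun_prop
  have hend : 2 * (Real.pi / 2) = Real.pi := by ring
  have hmem := intermediate_value_Ioo' (by positivity) hcont
    (show (0 : ℝ) ∈ _ by simp [hend])
  obtain ⟨x, hx, hx0⟩ := hmem
  refine ⟨x, ⟨hx, hx0⟩, ?_⟩
  rintro y ⟨hy, hy0⟩
  simp only at hx0
  have sin_pos : ∀ z ∈ Set.Ioo 0 (Real.pi / 2), 0 < Real.sin (2 * z) := fun z hz =>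
    Real.sin_pos_of_pos_of_lt_pi (by linarith [hz.1]) (by linarith [hz.2])
  have hsx := pow_pos (sin_pos x hx) 2
  have hsy := pow_pos (sin_pos y hy) 2
  rw [Real.sin_sq] at hsx hsy hx0 hy0
  have hprod : (Real.cos (2 * y) - Real.cos (2 * x)) *
      (1 + Real.cos (2 * y) * Real.cos (2 * x)) = 0 := by
    linear_combination (1 - Real.cos (2 * x) ^ 2) / 4 * hy0 -
      (1 - Real.cos (2 * y) ^ 2) / 4 * hx0
  have hpos : 0 < 1 + Real.cos (2 * y) * Real.cos (2 * x) := by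
    nlinarith [sq_nonneg (Real.cos (2 * y) + Real.cos (2 * x))]
  have hcos : Real.cos (2 * y) = Real.cos (2 * x) :=
    sub_eq_zero.mp ((mul_eq_zero.mp hprod).resolve_right hpos.ne')
  have h2 : 2 * y = 2 * x := Real.injOn_cos
    ⟨by linarith [hy.1], by linarith [hy.2]⟩ ⟨by linarith [hx.1], by linarith [hx.2]⟩ hcos
  linarith
end

section
/- For every real number d there exists exactly one x ∈ (π, 3π/2) such that d sin²(2x) + 4 cos(2x) = 0. (For θ₂ − θ₁ = π/2, there is exactly one rigid rotator on a rotating meridian with the third body in region III, i.e. θ₁ + π < θ₃ < θ₂ + π, for every value of d = ν₁ − ν₂.) -/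
/-- A point of `(-1, 1)` is determined by the ratio `a / (1 - a ^ 2)`. -/
theorem eq_of_mul_one_sub_sq_add_eq_zero {a b d : ℝ} (ha : a ∈ Set.Ioo (-1) 1)
    (hb : b ∈ Set.Ioo (-1) 1) (hda : d * (1 - a ^ 2) + 4 * a = 0)
    (hdb : d * (1 - b ^ 2) + 4 * b = 0) : a = b := by
  obtain ⟨ha₁, ha₂⟩ := ha
  obtain ⟨hb₁, hb₂⟩ := hb
  have hab : (a - b) * (1 + a * b) = 0 := by
    linear_combination (1 - b ^ 2) / 4 * hda - (1 - a ^ 2) / 4 * hdb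
  have hpos : 0 < 1 + a * b := by nlinarith
  exact sub_eq_zero.mp ((mul_eq_zero.mp hab).resolve_right hpos.ne')

theorem cos_mem_Ioo_of_mem_Ioo {y : ℝ} (hy : y ∈ Set.Ioo 0 Real.pi) :
    Real.cos y ∈ Set.Ioo (-1) 1 := by
  have hs := Real.sin_pos_of_mem_Ioo hy
  have := Real.sin_sq_add_cos_sq y
  constructor <;> nlinarith

/-- For θ₂ − θ₁ = π/2 there is exactly one rigid rotator on a rotating meridian with the
third body in region III, for every value of d = ν₁ − ν₂. -/
theorem stmt_11 (d : ℝ) :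
    ∃! x : ℝ, x ∈ Set.Ioo Real.pi (3 * Real.pi / 2) ∧
      d * Real.sin (2 * x) ^ 2 + 4 * Real.cos (2 * x) = 0 := by
  have hπ := Real.pi_pos
  refine existsUnique_of_exists_of_unique ?_ ?_
  · have hend : 2 * (3 * Real.pi / 2) = Real.pi + 2 * Real.pi := by ring
    have hcont : ContinuousOn
        (fun x : ℝ => d * Real.sin (2 * x) ^ 2 + 4 * Real.cos (2 * x))
        (Set.Icc Real.pi (3 * Real.pi / 2)) := by fun_prop
    refine intermediate_value_Ioo' (by linarith) hcont ?_
    simp only [hend, Real.sin_add_two_pi, Real.cos_add_two_pi, Real.sin_two_pi,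
      Real.cos_two_pi, Real.sin_pi, Real.cos_pi]
    norm_num
  · have shift : ∀ x : ℝ, x ∈ Set.Ioo Real.pi (3 * Real.pi / 2) ∧
        d * Real.sin (2 * x) ^ 2 + 4 * Real.cos (2 * x) = 0 →
        2 * x - 2 * Real.pi ∈ Set.Ioo 0 Real.pi ∧
        d * (1 - Real.cos (2 * x - 2 * Real.pi) ^ 2)
          + 4 * Real.cos (2 * x - 2 * Real.pi) = 0 := by
      rintro x ⟨⟨h₁, h₂⟩, h⟩
      refine ⟨⟨by linarith, by linarith⟩, ?_⟩
      rwa [Real.cos_sub_two_pi, ← Real.sin_sq]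
    intro x y hx hy
    obtain ⟨hx, hdx⟩ := shift x hx
    obtain ⟨hy, hdy⟩ := shift y hy
    have hcos := eq_of_mul_one_sub_sq_add_eq_zero (cos_mem_Ioo_of_mem_Ioo hx)
      (cos_mem_Ioo_of_mem_Ioo hy) hdx hdy
    have := Real.injOn_cos (Set.Ioo_subset_Icc_self hx) (Set.Ioo_subset_Icc_self hy) hcos
    linarith
end

section
/- For a real number d, the set { x ∈ (3π/2, 2π) : d·(1 − cos(4x)) = −8 } has exactly 0 elements if d > −4, exactly 1 element if d = −4, and exactly 2 elements if d < −4. (For θ₂ − θ₁ = π/2, the number of rigid rotators on a rotating meridian with the third body in region IV, i.e. θ₂ + π < θ₃ < θ₁ + 2π, is 0, 1, or 2 according as ν₁ − ν₂ > −4, = −4, or < −4.) -/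
theorem cos_four_mul_eq_cos_iff {x θ : ℝ}
    (hx : x ∈ Set.Ioo (3 * Real.pi / 2) (2 * Real.pi)) (h0 : 0 ≤ θ) (hπ : θ ≤ Real.pi) :
    Real.cos (4 * x) = Real.cos θ ↔ x = 3 * Real.pi / 2 + θ / 4 ∨ x = 2 * Real.pi - θ / 4 := by
  obtain ⟨hx₁, hx₂⟩ := hx
  have hleft : Real.cos (4 * x) = Real.cos (4 * x - 6 * Real.pi) := by
    rw [← Real.cos_sub_nat_mul_two_pi (4 * x) 3]
    congr 1
    push_cast
    ring
  have hright : Real.cos (4 * x) = Real.cos (8 * Real.pi - 4 * x) := by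
    rw [← Real.cos_nat_mul_two_pi_sub (4 * x) 4]
    congr 1
    push_cast
    ring
  constructor
  · intro h
    rcases le_total (4 * x - 6 * Real.pi) Real.pi with hle | hle
    · left
      have := Real.injOn_cos ⟨by linarith, hle⟩ ⟨h0, hπ⟩ (hleft.symm.trans h)
      linarith
    · right
      have := Real.injOn_cos ⟨by linarith, by linarith⟩ ⟨h0, hπ⟩ (hright.symm.trans h)
      linarith
  · rintro (h | h)
    · rw [hleft, h]
      congr 1
      ring
    · rw [hright, h]
      congr 1
      ring

theorem setOf_mul_one_sub_cos_four_mul_eq {d θ : ℝ} (h0 : 0 < θ) (hπ : θ ≤ Real.pi)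
    (hd : d ≠ 0) (hθ : d * (1 - Real.cos θ) = -8) :
    {x : ℝ | x ∈ Set.Ioo (3 * Real.pi / 2) (2 * Real.pi) ∧
        d * (1 - Real.cos (4 * x)) = -8} =
      {3 * Real.pi / 2 + θ / 4, 2 * Real.pi - θ / 4} := by
  have hiff : ∀ x : ℝ, d * (1 - Real.cos (4 * x)) = -8 ↔ Real.cos (4 * x) = Real.cos θ := by
    intro x
    rw [← hθ, mul_right_inj' hd, sub_right_inj]
  ext x
  simp only [Set.mem_ofPred_eq, Set.mem_insert_iff, Set.mem_singleton_iff, hiff]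
  constructor
  · rintro ⟨hx, h⟩
    exact (cos_four_mul_eq_cos_iff hx h0.le hπ).1 h
  · intro h
    have hx : x ∈ Set.Ioo (3 * Real.pi / 2) (2 * Real.pi) := by
      rcases h with rfl | rfl <;> constructor <;> linarith
    exact ⟨hx, (cos_four_mul_eq_cos_iff hx h0.le hπ).2 h⟩

/-- For θ₂ − θ₁ = π/2, the number of rigid rotators on a rotating meridian with the third
body in region IV is 0, 1, or 2 according as d = ν₁ − ν₂ > −4, = −4, or < −4. -/
theorem stmt_12 (d : ℝ) :
    (-4 < d → {x : ℝ | x ∈ Set.Ioo (3 * Real.pi / 2) (2 * Real.pi) ∧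
        d * (1 - Real.cos (4 * x)) = -8}.encard = 0) ∧
    (d = -4 → {x : ℝ | x ∈ Set.Ioo (3 * Real.pi / 2) (2 * Real.pi) ∧
        d * (1 - Real.cos (4 * x)) = -8}.encard = 1) ∧
    (d < -4 → {x : ℝ | x ∈ Set.Ioo (3 * Real.pi / 2) (2 * Real.pi) ∧
        d * (1 - Real.cos (4 * x)) = -8}.encard = 2) := by
  refine ⟨fun hd => ?_, fun hd => ?_, fun hd => ?_⟩
  · rw [Set.encard_eq_zero, Set.eq_empty_iff_forall_notMem]
    rintro x ⟨-, h⟩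
    have h₁ := Real.neg_one_le_cos (4 * x)
    have h₂ := Real.cos_le_one (4 * x)
    rcases h₂.eq_or_lt with h₂ | h₂
    · rw [h₂] at h
      norm_num at h
    · nlinarith [mul_pos (sub_pos.2 hd) (sub_pos.2 h₂)]
  · rw [setOf_mul_one_sub_cos_four_mul_eq Real.pi_pos le_rfl (by linarith)
      (by rw [Real.cos_pi, hd]; norm_num)]
    rw [show 2 * Real.pi - Real.pi / 4 = 3 * Real.pi / 2 + Real.pi / 4 by ring,
      Set.pair_eq_singleton, Set.encard_singleton]
  · have hd0 : d < 0 := by linarith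
    have hlt : 1 + 8 / d < 1 := by
      linarith [div_neg_of_pos_of_neg (by norm_num : (0 : ℝ) < 8) hd0]
    have hgt : -1 < 1 + 8 / d := by
      have : -2 < 8 / d := by
        rw [lt_div_iff_of_neg hd0]
        linarith
      linarith
    have hπ : Real.arccos (1 + 8 / d) < Real.pi :=
      lt_of_le_of_ne (Real.arccos_le_pi _) fun h => hgt.not_ge (Real.arccos_eq_pi.1 h)
    rw [setOf_mul_one_sub_cos_four_mul_eq (Real.arccos_pos.2 hlt) hπ.le hd0.ne
      (by rw [Real.cos_arccos hgt.le hlt.le]; field_simp [hd0.ne]; ring)]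
    exact Set.encard_pair (by intro h; linarith)
end

section
/- For all real numbers ν₁, ν₂, a, the following trigonometric identity holds: g_I(a/2) = (ν₁ − ν₂)·(4 cos²a + 4 cos a − 1)·sin a · sin⁴(a/2), where g_I(x) = −sin²x·sin²(x−a)·(ν₁ sin 2x + ν₂ sin 2(x−a)) − sin²a·(sin²x·sin 2x + sin²(x−a)·sin 2(x−a)) − sin²a·sin 2a·(ν₂ sin²x − ν₁ sin²(x−a)). (The 'smaller' isosceles configuration x = a/2 in region I is a rigid rotator on a rotating meridian for the cotangent potential exactly when ν₁ = ν₂ or 4cos²a + 4cos a − 1 = 0, i.e. cos a = (√2 − 1)/2.) -/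
/-- The 'smaller' isosceles configuration x = a/2 in region I is a rigid rotator on a
rotating meridian for the cotangent potential exactly when ν₁ = ν₂ or
4cos²a + 4cos a − 1 = 0. -/
theorem stmt_13 (ν₁ ν₂ a : ℝ) :
    -Real.sin (a / 2) ^ 2 * Real.sin (a / 2 - a) ^ 2 *
        (ν₁ * Real.sin (2 * (a / 2)) + ν₂ * Real.sin (2 * (a / 2 - a))) -
      Real.sin a ^ 2 * (Real.sin (a / 2) ^ 2 * Real.sin (2 * (a / 2)) +
        Real.sin (a / 2 - a) ^ 2 * Real.sin (2 * (a / 2 - a))) -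
      Real.sin a ^ 2 * Real.sin (2 * a) *
        (ν₂ * Real.sin (a / 2) ^ 2 - ν₁ * Real.sin (a / 2 - a) ^ 2) =
    (ν₁ - ν₂) * (4 * Real.cos a ^ 2 + 4 * Real.cos a - 1) * Real.sin a *
      Real.sin (a / 2) ^ 4 := by
  have sin_sub : Real.sin (a / 2 - a) = -Real.sin (a / 2) := by
    rw [← Real.sin_neg]; congr 1; ring
  have sin_two_sub : Real.sin (2 * (a / 2 - a)) = -Real.sin a := by
    rw [← Real.sin_neg]; congr 1; ring
  have two_half : 2 * (a / 2) = a := by ring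
  have sin_sq : Real.sin a ^ 2 = 2 * Real.sin (a / 2) ^ 2 * (1 + Real.cos a) := by
    have half_sq := Real.sin_sq_eq_half_sub (a / 2)
    rw [two_half] at half_sq
    rw [half_sq, Real.sin_sq]
    ring
  rw [sin_sub, sin_two_sub, two_half, Real.sin_two_mul]
  linear_combination 2 * (ν₁ - ν₂) * Real.sin a * Real.cos a * Real.sin (a / 2) ^ 2 * sin_sq
end

section
/- For all real numbers ν₁, ν₂, a, the following trigonometric identity holds: g_III(a/2 + π) = −(ν₁ − ν₂)·(2 cos a + 1)²·sin a · sin⁴(a/2), where g_III(x) = −sin²x·sin²(x−a)·(ν₁ sin 2x + ν₂ sin 2(x−a)) + sin²a·(sin²x·sin 2x + sin²(x−a)·sin 2(x−a)) − sin²a·sin 2a·(ν₁ sin²(x−a) − ν₂ sin²x). (The 'larger' isosceles configuration x = a/2 + π in region III is a rigid rotator on a rotating meridian for the cotangent potential exactly when ν₁ = ν₂ or 2cos a + 1 = 0, i.e. a = 2π/3, the equilateral case.) -/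
/-- The 'larger' isosceles configuration x = a/2 + π in region III is a rigid rotator on a
rotating meridian for the cotangent potential exactly when ν₁ = ν₂ or 2cos a + 1 = 0. -/
theorem stmt_14 (ν₁ ν₂ a : ℝ) :
    -Real.sin (a / 2 + Real.pi) ^ 2 * Real.sin (a / 2 + Real.pi - a) ^ 2 *
        (ν₁ * Real.sin (2 * (a / 2 + Real.pi)) + ν₂ * Real.sin (2 * (a / 2 + Real.pi - a))) +
      Real.sin a ^ 2 * (Real.sin (a / 2 + Real.pi) ^ 2 * Real.sin (2 * (a / 2 + Real.pi)) +
        Real.sin (a / 2 + Real.pi - a) ^ 2 * Real.sin (2 * (a / 2 + Real.pi - a))) -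
      Real.sin a ^ 2 * Real.sin (2 * a) *
        (ν₁ * Real.sin (a / 2 + Real.pi - a) ^ 2 - ν₂ * Real.sin (a / 2 + Real.pi) ^ 2) =
    -(ν₁ - ν₂) * (2 * Real.cos a + 1) ^ 2 * Real.sin a * Real.sin (a / 2) ^ 4 := by
  have h₁ : Real.sin (a / 2 + Real.pi) = -Real.sin (a / 2) := Real.sin_add_pi _
  have h₂ : Real.sin (a / 2 + Real.pi - a) = Real.sin (a / 2) := by
    rw [show a / 2 + Real.pi - a = Real.pi - a / 2 by ring, Real.sin_pi_sub]
  have h₃ : Real.sin (2 * (a / 2 + Real.pi)) = Real.sin a := by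
    rw [show 2 * (a / 2 + Real.pi) = a + 2 * Real.pi by ring, Real.sin_add_two_pi]
  have h₄ : Real.sin (2 * (a / 2 + Real.pi - a)) = -Real.sin a := by
    rw [show 2 * (a / 2 + Real.pi - a) = -a + 2 * Real.pi by ring, Real.sin_add_two_pi,
      Real.sin_neg]
  have hcos : Real.cos a = 1 - 2 * Real.sin (a / 2) ^ 2 := by
    have h := Real.cos_two_mul (a / 2)
    rw [show 2 * (a / 2) = a by ring, Real.cos_sq'] at h
    linarith
  have hsin : Real.sin a ^ 2 = 1 - Real.cos a ^ 2 := Real.sin_sq a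
  rw [h₁, h₂, h₃, h₄, Real.sin_two_mul, hsin, hcos]
  ring
end

section
/- Fix ν₁, ν₂ > 0 and λ > 0, and define g_II(x, a) = sin²x·sin²(x−a)·(ν₁ sin 2x + ν₂ sin 2(x−a)) − sin²a·(sin²x·sin 2x − sin²(x−a)·sin 2(x−a)) − sin²a·sin 2a·(ν₂ sin²x + ν₁ sin²(x−a)). Then, as a → 0⁺, the quantity g_II((1+λ)a, a)/a⁵ converges to 2·( (ν₁+ν₂)λ⁵ + (3ν₁+2ν₂)λ⁴ + (3ν₁+ν₂)λ³ − (ν₂+3)λ² − (2ν₂+3)λ − (ν₂+1) ). (In the limit R → ∞ the rigid-rotator equation on a rotating meridian for the cotangent potential reduces, at lowest order, to Euler's quintic polynomial (m₁+m₂)λ⁵ + (3m₁+2m₂)λ⁴ + (3m₁+m₂)λ³ − (m₂+3m₃)λ² − (2m₂+3m₃)λ − (m₂+m₃) = 0 for collinear central configurations on the Euclidean plane, with ν₁ = m₁/m₃ and ν₂ = m₂/m₃.) -/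
/-- The first-order behaviour of `sin (c * a)` as `a` tends to `0`. -/
lemma tendsto_sin_mul_div_self (c : ℝ) :
    Filter.Tendsto (fun a : ℝ => Real.sin (c * a) / a) (nhdsWithin 0 (Set.Ioi 0)) (nhds c) := by
  have h : HasDerivAt (fun a : ℝ => Real.sin (c * a)) c 0 := by
    simpa using ((hasDerivAt_id (0 : ℝ)).const_mul c).sin
  have h' := h.tendsto_slope_zero_right
  simpa [div_eq_inv_mul] using h'

/-- In the flat limit R → ∞ (i.e. a → 0⁺ with x = (1+λ)a), the rigid-rotator equation on a
rotating meridian for the cotangent potential reduces, at lowest order, to Euler's quintic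
polynomial for collinear central configurations on the Euclidean plane. -/
theorem stmt_15 (ν₁ ν₂ lam : ℝ) (hν₁ : 0 < ν₁) (hν₂ : 0 < ν₂) (hlam : 0 < lam) :
    Filter.Tendsto (fun a : ℝ =>
      (Real.sin ((1 + lam) * a) ^ 2 * Real.sin ((1 + lam) * a - a) ^ 2 *
          (ν₁ * Real.sin (2 * ((1 + lam) * a)) + ν₂ * Real.sin (2 * ((1 + lam) * a - a))) -
        Real.sin a ^ 2 * (Real.sin ((1 + lam) * a) ^ 2 * Real.sin (2 * ((1 + lam) * a)) -
          Real.sin ((1 + lam) * a - a) ^ 2 * Real.sin (2 * ((1 + lam) * a - a))) -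
        Real.sin a ^ 2 * Real.sin (2 * a) *
          (ν₂ * Real.sin ((1 + lam) * a) ^ 2 + ν₁ * Real.sin ((1 + lam) * a - a) ^ 2)) / a ^ 5)
      (nhdsWithin 0 (Set.Ioi 0))
      (nhds (2 * ((ν₁ + ν₂) * lam ^ 5 + (3 * ν₁ + 2 * ν₂) * lam ^ 4 +
        (3 * ν₁ + ν₂) * lam ^ 3 - (ν₂ + 3) * lam ^ 2 - (2 * ν₂ + 3) * lam - (ν₂ + 1)))) := by
  have hx := tendsto_sin_mul_div_self (1 + lam)
  have hy := tendsto_sin_mul_div_self lam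
  have ha := tendsto_sin_mul_div_self 1
  have h2x := tendsto_sin_mul_div_self (2 * (1 + lam))
  have h2y := tendsto_sin_mul_div_self (2 * lam)
  have h2a := tendsto_sin_mul_div_self 2
  have key :=
    ((((hx.pow 2).mul (hy.pow 2)).mul ((h2x.const_mul ν₁).add (h2y.const_mul ν₂))).sub
      ((ha.pow 2).mul (((hx.pow 2).mul h2x).sub ((hy.pow 2).mul h2y)))).sub
      (((ha.pow 2).mul h2a).mul (((hx.pow 2).const_mul ν₂).add ((hy.pow 2).const_mul ν₁)))
  convert key.congr' ?_ using 2
  · ring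
  · filter_upwards [self_mem_nhdsWithin] with a ha0
    have hne : a ≠ 0 := ne_of_gt ha0
    rw [show (1 + lam) * a - a = lam * a by ring, ← mul_assoc 2 (1 + lam) a,
      ← mul_assoc 2 lam a, one_mul]
    field_simp
end

section
/- Let ν₁, ν₂ > 0 and let a ∈ (0, π) with a ≠ π/2. Define g_I(x) = −sin²x·sin²(x−a)·(ν₁ sin 2x + ν₂ sin 2(x−a)) − sin²a·(sin²x·sin 2x + sin²(x−a)·sin 2(x−a)) − sin²a·sin 2a·(ν₂ sin²x − ν₁ sin²(x−a)) and g_III(x) = −sin²x·sin²(x−a)·(ν₁ sin 2x + ν₂ sin 2(x−a)) + sin²a·(sin²x·sin 2x + sin²(x−a)·sin 2(x−a)) − sin²a·sin 2a·(ν₁ sin²(x−a) − ν₂ sin²x). Then there exists x ∈ (0, a) with g_I(x) = 0 and there exists x ∈ (π, π + a) with g_III(x) = 0. (There exist at least two rigid rotators on a rotating meridian: at least one in region I and at least one in region III.) -/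
/-- The rigid rotator function in region I (signs α = 1, β = −1). -/
noncomputable def gI (ν₁ ν₂ a x : ℝ) : ℝ :=
  -Real.sin x ^ 2 * Real.sin (x - a) ^ 2 *
      (ν₁ * Real.sin (2 * x) + ν₂ * Real.sin (2 * (x - a))) -
    Real.sin a ^ 2 * (Real.sin x ^ 2 * Real.sin (2 * x) +
      Real.sin (x - a) ^ 2 * Real.sin (2 * (x - a))) -
    Real.sin a ^ 2 * Real.sin (2 * a) *
      (ν₂ * Real.sin x ^ 2 - ν₁ * Real.sin (x - a) ^ 2)

/-- The rigid rotator function in region III (signs α = −1, β = 1). -/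
noncomputable def gIII (ν₁ ν₂ a x : ℝ) : ℝ :=
  -Real.sin x ^ 2 * Real.sin (x - a) ^ 2 *
      (ν₁ * Real.sin (2 * x) + ν₂ * Real.sin (2 * (x - a))) +
    Real.sin a ^ 2 * (Real.sin x ^ 2 * Real.sin (2 * x) +
      Real.sin (x - a) ^ 2 * Real.sin (2 * (x - a))) -
    Real.sin a ^ 2 * Real.sin (2 * a) *
      (ν₁ * Real.sin (x - a) ^ 2 - ν₂ * Real.sin x ^ 2)

/-- A continuous function whose values at the ends of an interval have opposite signs
vanishes in its interior. -/
theorem exists_mem_Ioo_eq_zero_of_mul_neg {f : ℝ → ℝ} (hf : Continuous f) {u v : ℝ}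
    (huv : u ≤ v) (h : f u * f v < 0) : ∃ x ∈ Set.Ioo u v, f x = 0 := by
  rcases mul_neg_iff.mp h with ⟨hu, hv⟩ | ⟨hu, hv⟩
  · exact intermediate_value_Ioo' huv hf.continuousOn ⟨hv, hu⟩
  · exact intermediate_value_Ioo huv hf.continuousOn ⟨hu, hv⟩

theorem continuous_gI (ν₁ ν₂ a : ℝ) : Continuous (gI ν₁ ν₂ a) := by
  unfold gI
  fun_prop

theorem continuous_gIII (ν₁ ν₂ a : ℝ) : Continuous (gIII ν₁ ν₂ a) := by
  unfold gIII
  fun_prop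

theorem gI_zero (ν₁ ν₂ a : ℝ) :
    gI ν₁ ν₂ a 0 = 2 * (ν₁ + 1) * Real.cos a * Real.sin a ^ 5 := by
  simp only [gI, Real.sin_two_mul, zero_sub, Real.sin_neg, Real.cos_neg, Real.sin_zero]
  ring

theorem gI_self (ν₁ ν₂ a : ℝ) :
    gI ν₁ ν₂ a a = -(2 * (ν₂ + 1) * Real.cos a * Real.sin a ^ 5) := by
  simp only [gI, Real.sin_two_mul, sub_self, Real.sin_zero]
  ring

/-- The functions of regions I and III are opposite under translation by `π`, up to a term vanishing at
the ends of the regions. -/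
theorem gIII_pi_add (ν₁ ν₂ a x : ℝ) :
    gIII ν₁ ν₂ a (Real.pi + x) =
      -gI ν₁ ν₂ a x - 2 * Real.sin x ^ 2 * Real.sin (x - a) ^ 2 *
        (ν₁ * Real.sin (2 * x) + ν₂ * Real.sin (2 * (x - a))) := by
  have h : x + Real.pi - a = x - a + Real.pi := by ring
  simp only [gIII, gI, add_comm Real.pi x, h, Real.sin_two_mul, Real.sin_add_pi,
    Real.cos_add_pi]
  ring

theorem gIII_pi (ν₁ ν₂ a : ℝ) :
    gIII ν₁ ν₂ a Real.pi = -(2 * (ν₁ + 1) * Real.cos a * Real.sin a ^ 5) := by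
  simpa [gI_zero] using gIII_pi_add ν₁ ν₂ a 0

theorem gIII_pi_add_self (ν₁ ν₂ a : ℝ) :
    gIII ν₁ ν₂ a (Real.pi + a) = 2 * (ν₂ + 1) * Real.cos a * Real.sin a ^ 5 := by
  simpa [gI_self] using gIII_pi_add ν₁ ν₂ a a

theorem cos_ne_zero_of_mem_Ioo {a : ℝ} (ha : a ∈ Set.Ioo 0 Real.pi)
    (ha' : a ≠ Real.pi / 2) : Real.cos a ≠ 0 := by
  intro h
  refine ha' (Real.injOn_cos ⟨ha.1.le, ha.2.le⟩ ?_ (h.trans Real.cos_pi_div_two.symm))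
  constructor <;> linarith [Real.pi_pos]

/-- There exist at least two rigid rotators on a rotating meridian: at least one in
region I and at least one in region III. -/
theorem stmt_16 (ν₁ ν₂ a : ℝ) (hν₁ : 0 < ν₁) (hν₂ : 0 < ν₂)
    (ha : a ∈ Set.Ioo 0 Real.pi) (ha' : a ≠ Real.pi / 2) :
    (∃ x ∈ Set.Ioo 0 a, gI ν₁ ν₂ a x = 0) ∧
    (∃ x ∈ Set.Ioo Real.pi (Real.pi + a), gIII ν₁ ν₂ a x = 0) := by
  have hsin : 0 < Real.sin a := Real.sin_pos_of_mem_Ioo ha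
  have hcos : Real.cos a ≠ 0 := cos_ne_zero_of_mem_Ioo ha ha'
  have hpos : 0 < 4 * (ν₁ + 1) * (ν₂ + 1) * Real.cos a ^ 2 * Real.sin a ^ 10 := by
    positivity
  constructor
  · refine exists_mem_Ioo_eq_zero_of_mul_neg (continuous_gI ν₁ ν₂ a) ha.1.le ?_
    rw [gI_zero, gI_self]
    linarith
  · refine exists_mem_Ioo_eq_zero_of_mul_neg (continuous_gIII ν₁ ν₂ a)
      (le_add_of_nonneg_right ha.1.le) ?_
    rw [gIII_pi, gIII_pi_add_self]
    linarith
end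

section
/- Let ν₁ = 3, ν₂ = 2, a = π/6. Define g_II(x) = sin²x·sin²(x−a)·(ν₁ sin 2x + ν₂ sin 2(x−a)) − sin²a·(sin²x·sin 2x − sin²(x−a)·sin 2(x−a)) − sin²a·sin 2a·(ν₂ sin²x + ν₁ sin²(x−a)) and g_IV(x) = sin²x·sin²(x−a)·(ν₁ sin 2x + ν₂ sin 2(x−a)) + sin²a·(sin²x·sin 2x − sin²(x−a)·sin 2(x−a)) + sin²a·sin 2a·(ν₂ sin²x + ν₁ sin²(x−a)). Then there exist two distinct points x ∈ (π/6, π) with g_II(x) = 0, and two distinct points x ∈ (7π/6, 2π) with g_IV(x) = 0. (For mass ratios m₁ : m₂ : m₃ = 3 : 2 : 1 and θ₂ − θ₁ = π/6, there are at least two rigid rotators in region II and at least two in region IV; together with the ones in regions I and III this gives at least six rigid rotators on a rotating meridian.) -/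
/-- The rigid rotator function in region II (signs α = β = 1) for ν₁ = 3, ν₂ = 2,
a = π/6. -/
noncomputable def gII (x : ℝ) : ℝ :=
  Real.sin x ^ 2 * Real.sin (x - Real.pi / 6) ^ 2 *
      (3 * Real.sin (2 * x) + 2 * Real.sin (2 * (x - Real.pi / 6))) -
    Real.sin (Real.pi / 6) ^ 2 * (Real.sin x ^ 2 * Real.sin (2 * x) -
      Real.sin (x - Real.pi / 6) ^ 2 * Real.sin (2 * (x - Real.pi / 6))) -
    Real.sin (Real.pi / 6) ^ 2 * Real.sin (2 * (Real.pi / 6)) *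
      (2 * Real.sin x ^ 2 + 3 * Real.sin (x - Real.pi / 6) ^ 2)

/-- The rigid rotator function in region IV (signs α = β = −1) for ν₁ = 3, ν₂ = 2,
a = π/6. -/
noncomputable def gIV (x : ℝ) : ℝ :=
  Real.sin x ^ 2 * Real.sin (x - Real.pi / 6) ^ 2 *
      (3 * Real.sin (2 * x) + 2 * Real.sin (2 * (x - Real.pi / 6))) +
    Real.sin (Real.pi / 6) ^ 2 * (Real.sin x ^ 2 * Real.sin (2 * x) -
      Real.sin (x - Real.pi / 6) ^ 2 * Real.sin (2 * (x - Real.pi / 6))) +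
    Real.sin (Real.pi / 6) ^ 2 * Real.sin (2 * (Real.pi / 6)) *
      (2 * Real.sin x ^ 2 + 3 * Real.sin (x - Real.pi / 6) ^ 2)

theorem continuous_gII : Continuous gII := by
  unfold gII
  fun_prop

theorem continuous_gIV : Continuous gIV := by
  unfold gIV
  fun_prop

theorem sin_two_mul_pi_div_six : Real.sin (2 * (Real.pi / 6)) = √3 / 2 := by
  rw [← Real.sin_pi_div_three]
  ring_nf

theorem sin_two_mul_pi_div_three_s17 : Real.sin (2 * (Real.pi / 3)) = √3 / 2 := by
  rw [Real.sin_two_mul, Real.sin_pi_div_three, Real.cos_pi_div_three]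
  ring

theorem gII_pi_div_six : gII (Real.pi / 6) = -(3 * √3 / 32) := by
  simp only [gII, sub_self, mul_zero, Real.sin_zero, sin_two_mul_pi_div_six, Real.sin_pi_div_six]
  ring

theorem gII_pi_div_two : gII (Real.pi / 2) = 5 * √3 / 16 := by
  have h : Real.pi / 2 - Real.pi / 6 = Real.pi / 3 := by ring
  have hp : 2 * (Real.pi / 2) = Real.pi := by ring
  have h3 : √3 ^ 2 = 3 := Real.sq_sqrt (by norm_num)
  simp only [gII, h, hp, sin_two_mul_pi_div_six, sin_two_mul_pi_div_three_s17, Real.sin_pi_div_six,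
    Real.sin_pi_div_three, Real.sin_pi_div_two, Real.sin_pi, div_pow, h3]
  ring

theorem gII_pi : gII Real.pi = -(√3 / 8) := by
  have h : 2 * (Real.pi - Real.pi / 6) = 2 * Real.pi - 2 * (Real.pi / 6) := by ring
  simp only [gII, h, Real.sin_two_pi_sub, Real.sin_pi_sub, Real.sin_two_pi,
    sin_two_mul_pi_div_six, Real.sin_pi_div_six, Real.sin_pi]
  ring

theorem gIV_add_pi (x : ℝ) : gIV (x + Real.pi) = gIV x := by
  have h (y : ℝ) : Real.sin (2 * (y + Real.pi)) = Real.sin (2 * y) := by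
    rw [mul_add, Real.sin_add_two_pi]
  simp only [gIV, add_sub_right_comm x, h, Real.sin_add_pi, neg_sq]

theorem gIV_pi_div_six : gIV (Real.pi / 6) = 3 * √3 / 32 := by
  simp only [gIV, sub_self, mul_zero, Real.sin_zero, sin_two_mul_pi_div_six, Real.sin_pi_div_six]
  ring

theorem gIV_three_mul_pi_div_four : gIV (3 * Real.pi / 4) = -(5 * (5 + √3) / 32) := by
  have hd : 2 * (3 * Real.pi / 4) = Real.pi / 2 + Real.pi := by ring
  have he : 2 * (3 * Real.pi / 4 - Real.pi / 6) = Real.pi / 6 + Real.pi := by ring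
  have h3 : √3 * √3 = 3 := Real.mul_self_sqrt (by norm_num)
  have hs : Real.sin (3 * Real.pi / 4) ^ 2 = 1 / 2 := by
    rw [Real.sin_sq_eq_half_sub, hd, Real.cos_add_pi, Real.cos_pi_div_two]
    ring
  have ht : Real.sin (3 * Real.pi / 4 - Real.pi / 6) ^ 2 = (2 + √3) / 4 := by
    rw [Real.sin_sq_eq_half_sub, he, Real.cos_add_pi, Real.cos_pi_div_six]
    ring
  simp only [gIV, hs, ht, hd, he, Real.sin_add_pi, Real.sin_pi_div_two,
    sin_two_mul_pi_div_six, Real.sin_pi_div_six]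
  linear_combination (3 / 32) * h3

theorem gIV_pi : gIV Real.pi = √3 / 8 := by
  have h : 2 * (Real.pi - Real.pi / 6) = 2 * Real.pi - 2 * (Real.pi / 6) := by ring
  simp only [gIV, h, Real.sin_two_pi_sub, Real.sin_pi_sub, Real.sin_two_pi,
    sin_two_mul_pi_div_six, Real.sin_pi_div_six, Real.sin_pi]
  ring

/-- A continuous function that is negative at `a` and `c` and positive at a point `b` between
them has two distinct zeros in `(a, c)`. -/
theorem exists_two_zeros_of_neg_pos_neg {f : ℝ → ℝ} (hf : Continuous f) {a b c : ℝ}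
    (hab : a < b) (hbc : b < c) (ha : f a < 0) (hb : 0 < f b) (hc : f c < 0) :
    ∃ x ∈ Set.Ioo a c, ∃ y ∈ Set.Ioo a c, x ≠ y ∧ f x = 0 ∧ f y = 0 := by
  obtain ⟨x, hx, hfx⟩ := intermediate_value_Ioo hab.le hf.continuousOn ⟨ha, hb⟩
  obtain ⟨y, hy, hfy⟩ := intermediate_value_Ioo' hbc.le hf.continuousOn ⟨hc, hb⟩
  exact ⟨x, ⟨hx.1, hx.2.trans hbc⟩, y, ⟨hab.trans hy.1, hy.2⟩, (hx.2.trans hy.1).ne, hfx, hfy⟩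

/-- For mass ratios 3 : 2 : 1 and θ₂ − θ₁ = π/6 there are at least two rigid rotators in
region II and at least two in region IV. -/
theorem stmt_17 :
    (∃ x ∈ Set.Ioo (Real.pi / 6) Real.pi, ∃ y ∈ Set.Ioo (Real.pi / 6) Real.pi,
      x ≠ y ∧ gII x = 0 ∧ gII y = 0) ∧
    (∃ x ∈ Set.Ioo (7 * Real.pi / 6) (2 * Real.pi),
      ∃ y ∈ Set.Ioo (7 * Real.pi / 6) (2 * Real.pi),
      x ≠ y ∧ gIV x = 0 ∧ gIV y = 0) := by
  have hpi := Real.pi_pos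
  have h3 : 0 < √(3 : ℝ) := by positivity
  constructor
  · refine exists_two_zeros_of_neg_pos_neg continuous_gII (b := Real.pi / 2) (by linarith)
      (by linarith) ?_ ?_ ?_
    · rw [gII_pi_div_six]
      linarith
    · rw [gII_pi_div_two]
      linarith
    · rw [gII_pi]
      linarith
  · have key := exists_two_zeros_of_neg_pos_neg continuous_gIV.neg
      (a := 7 * Real.pi / 6) (b := 7 * Real.pi / 4) (c := 2 * Real.pi)
      (by linarith) (by linarith) ?_ ?_ ?_
    · simpa only [Pi.neg_apply, neg_eq_zero] using key
    · rw [Pi.neg_apply, show 7 * Real.pi / 6 = Real.pi / 6 + Real.pi by ring, gIV_add_pi,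
        gIV_pi_div_six]
      linarith
    · rw [Pi.neg_apply, show 7 * Real.pi / 4 = 3 * Real.pi / 4 + Real.pi by ring, gIV_add_pi,
        gIV_three_mul_pi_div_four]
      linarith
    · rw [Pi.neg_apply, two_mul, gIV_add_pi, gIV_pi]
      linarith
end

section
/- Let μ₁, μ₂, μ₃ > 0 be real numbers such that μ₁⁴·(μ₁² − (μ₂² + μ₃²)) = μ₂⁴·(μ₂² − (μ₃² + μ₁²)) = μ₃⁴·(μ₃² − (μ₁² + μ₂²)). Then μ₁ = μ₂ = μ₃. (Key lemma for the exceptional case G₁₂ = G₂₃ = G₃₁ and F₁₂ = F₂₃ = F₃₁ on a rotating meridian: this case occurs only for equal μ_k, i.e. equal masses, and then θ₁ − θ₂ = θ₂ − θ₃ = θ₃ − θ₁ = 2π/3, the equilateral fixed point.) -/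
/-- If `x² (x - (y + z)) = y² (y - (z + x))` then either `x = y` or the cofactor of `x - y`
in the difference of the two sides vanishes. -/
lemma eq_or_sq_add_sq_eq_of_sq_mul_sub_eq {x y z : ℝ}
    (h : x ^ 2 * (x - (y + z)) = y ^ 2 * (y - (z + x))) :
    x = y ∨ x ^ 2 + y ^ 2 = z * (x + y) := by
  have h' : (x - y) * (x ^ 2 + y ^ 2 - z * (x + y)) = 0 := by linear_combination h
  exact (mul_eq_zero.mp h').imp sub_eq_zero.mp sub_eq_zero.mp

lemma eq_and_eq_of_sq_mul_sub_eq {x y z : ℝ} (hx : 0 < x) (hy : 0 < y) (hz : 0 < z)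
    (hxy : x ^ 2 * (x - (y + z)) = y ^ 2 * (y - (z + x)))
    (hyz : y ^ 2 * (y - (z + x)) = z ^ 2 * (z - (x + y))) :
    x = y ∧ y = z := by
  rcases eq_or_sq_add_sq_eq_of_sq_mul_sub_eq hxy with rfl | h₁ <;>
    rcases eq_or_sq_add_sq_eq_of_sq_mul_sub_eq hyz with rfl | h₂
  · exact ⟨rfl, rfl⟩
  · exact ⟨rfl, mul_left_cancel₀ hz.ne' (by linear_combination -h₂)⟩
  · exact ⟨mul_left_cancel₀ hx.ne' (by linear_combination h₁), rfl⟩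
  · have hxz : x = z :=
      mul_left_cancel₀ (show x + y + z ≠ 0 by positivity) (by linear_combination h₁ - h₂)
    subst hxz
    have hyx : y = x := mul_left_cancel₀ hy.ne' (by linear_combination h₁)
    exact ⟨hyx.symm, hyx⟩


/-- Key lemma for the exceptional case G₁₂ = G₂₃ = G₃₁ and F₁₂ = F₂₃ = F₃₁ on a rotating
meridian: this case occurs only for equal μ_k. -/
theorem stmt_19 (μ₁ μ₂ μ₃ : ℝ)
    (hμ₁ : 0 < μ₁) (hμ₂ : 0 < μ₂) (hμ₃ : 0 < μ₃)
    (h12 : μ₁ ^ 4 * (μ₁ ^ 2 - (μ₂ ^ 2 + μ₃ ^ 2)) = μ₂ ^ 4 * (μ₂ ^ 2 - (μ₃ ^ 2 + μ₁ ^ 2)))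
    (h23 : μ₂ ^ 4 * (μ₂ ^ 2 - (μ₃ ^ 2 + μ₁ ^ 2)) = μ₃ ^ 4 * (μ₃ ^ 2 - (μ₁ ^ 2 + μ₂ ^ 2))) :
    μ₁ = μ₂ ∧ μ₂ = μ₃ := by
  obtain ⟨h₁, h₂⟩ := eq_and_eq_of_sq_mul_sub_eq (pow_pos hμ₁ 2) (pow_pos hμ₂ 2) (pow_pos hμ₃ 2)
    (by linear_combination h12) (by linear_combination h23)
  exact ⟨(pow_left_inj₀ hμ₁.le hμ₂.le two_ne_zero).mp h₁,
    (pow_left_inj₀ hμ₂.le hμ₃.le two_ne_zero).mp h₂⟩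
end
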